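/- Let G be a finite, non-abelian, solvable group and p a prime such that the commutator subgroup G' is the unique minimal normal subgroup of G and is cyclic of order p. Then either (i) G is a p-group with G' contained in the centre Z(G), or (ii) G is a Frobenius group with Frobenius kernel G' and abelian Frobenius complement. -/

import Mathlib

theorem aux_prime_le {G : Type} [Group G] (N H : Subgroup G) (p : ℕ) (hp : p.Prime)
    (hcard : Nat.card N = p) (n : G) (hn : n ∈ N) (hH : n ∈ H) (h1 : n ≠ 1) : N ≤ H := by
  haveI : Fact (Nat.card N).Prime := ⟨hcard ▸ hp⟩
  rcases (H.subgroupOf N).eq_bot_or_eq_top_of_prime_card with h | h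
  · exfalso
    have h2 : (⟨n, hn⟩ : N) ∈ H.subgroupOf N := by
      rw [Subgroup.mem_subgroupOf]; exact hH
    rw [h, Subgroup.mem_bot] at h2
    exact h1 (congrArg Subtype.val h2)
  · exact Subgroup.subgroupOf_eq_top.mp h

theorem aux_pow_comm {G : Type} [Group G] (x y c : G) (hc : x * y = c * (y * x))
    (hz : ∀ z, z * c = c * z) (k : ℕ) : x ^ k * y = c ^ k * (y * x ^ k) := by
  induction k with
  | zero => simp
  | succ k ih =>
    have hck : x * c ^ k = c ^ k * x := (show Commute x (c ^ k) from Commute.pow_right (hz x) k)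
    calc x ^ (k+1) * y = x * (x ^ k * y) := by rw [pow_succ' x k, mul_assoc]
      _ = (x * c ^ k) * (y * x ^ k) := by rw [ih, mul_assoc]
      _ = c ^ k * ((x * y) * x ^ k) := by rw [hck]; simp only [mul_assoc]
      _ = c ^ (k+1) * (y * x ^ (k+1)) := by
        rw [hc, pow_succ c, pow_succ' x]; simp only [mul_assoc]

/-- Let `G` be a finite, non-abelian, solvable group and `p` a prime
such that `G'` is the unique minimal normal subgroup of `G` and is cyclic of order `p`.
Then either (i) `G` is a `p`-group with `G' ⊆ Z(G)`, or (ii) `G` is a Frobenius group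
with Frobenius kernel `G'` and abelian Frobenius complement. -/
theorem pGroup_or_frobenius_of_unique_minimal_commutator
    (G : Type) [Group G] [Fintype G] (p : ℕ) (hp : p.Prime)
    (hnab : ¬ ∀ a b : G, a * b = b * a) (hsolv : IsSolvable G)
    (hnt : commutator G ≠ ⊥)
    (hmin : ∀ M : Subgroup G, M.Normal → M ≠ ⊥ → commutator G ≤ M)
    (hcyc : IsCyclic ↥(commutator G)) (hcard : Nat.card ↥(commutator G) = p) :
    (IsPGroup p G ∧ commutator G ≤ Subgroup.center G) ∨
    (∃ A : Subgroup G, A ≠ ⊥ ∧ A ≠ ⊤ ∧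
      (∀ g : G, g ∉ A → A ⊓ Subgroup.map (MulAut.conj g).toMonoidHom A = ⊥) ∧
      commutator G ⊓ A = ⊥ ∧ commutator G ⊔ A = ⊤ ∧
      (∀ a b : G, a ∈ A → b ∈ A → a * b = b * a)) := by
  classical
  have hcomm : ∀ a b : G, a * b * a⁻¹ * b⁻¹ ∈ commutator G := fun a b =>
    Subgroup.commutator_mem_commutator (Subgroup.mem_top a) (Subgroup.mem_top b)
  have hNn : (commutator G).Normal := inferInstance
  set N := commutator G with hN
  by_cases hZ : N ≤ Subgroup.center G
  · left
    refine ⟨?_, hZ⟩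
    haveI : Fact p.Prime := ⟨hp⟩
    -- central elements of prime order have order p
    have hzq : ∀ z : G, z ∈ Subgroup.center G → ∀ q : ℕ, q.Prime → orderOf z = q → q = p := by
      intro z hz q hq ho
      have hnorm : (Subgroup.zpowers z).Normal := by
        refine ⟨fun n hn g => ?_⟩
        have hle : Subgroup.zpowers z ≤ Subgroup.center G := by
          rw [Subgroup.zpowers_le]; exact hz
        have := Subgroup.mem_center_iff.mp (hle hn) g
        rw [this]; simpa using hn
      have hne : Subgroup.zpowers z ≠ ⊥ := by
        rw [Ne, Subgroup.zpowers_eq_bot]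
        rintro rfl
        rw [orderOf_one] at ho
        exact hq.one_lt.ne ho
      have hle := hmin _ hnorm hne
      have hd := Subgroup.card_dvd_of_le hle
      rw [hcard, Nat.card_zpowers, ho] at hd
      exact ((Nat.prime_dvd_prime_iff_eq hp hq).mp hd).symm
    have hpz : ∀ x : G, x ^ p ∈ Subgroup.center G := by
      intro x
      rw [Subgroup.mem_center_iff]
      intro y
      have hc := hcomm x y
      have h1 := aux_pow_comm x y (x * y * x⁻¹ * y⁻¹) (by group)
        (fun z => Subgroup.mem_center_iff.mp (hZ hc) z) p
      have h2 : (x * y * x⁻¹ * y⁻¹) ^ p = 1 := by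
        have h3 : (⟨_, hc⟩ : N) ^ p = 1 := by rw [← hcard]; exact pow_card_eq_one'
        exact congrArg Subtype.val h3
      rw [h2, one_mul] at h1
      exact h1.symm
    intro x
    have hx0 : orderOf x ≠ 0 := (orderOf_pos x).ne'
    have key : ∀ q : ℕ, q.Prime → q ∣ orderOf x → q = p := by
      intro q hq hd
      by_contra hqp
      have ho : orderOf (x ^ (orderOf x / q)) = q := orderOf_pow_orderOf_div hx0 hd
      have ho2 : orderOf ((x ^ (orderOf x / q)) ^ p) = q := by
        rw [Nat.Coprime.orderOf_pow, ho]
        rw [ho]; exact (Nat.coprime_primes hq hp).mpr hqp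
      exact hqp (hzq _ (hpz _) q hq ho2)
    refine ⟨(orderOf x).primeFactorsList.length, ?_⟩
    rw [← Nat.eq_prime_pow_of_unique_prime_dvd hx0 (fun {d} h1 h2 => key d h1 h2)]
    exact pow_orderOf_eq_one x
  · right
    have hcen : Subgroup.center G = ⊥ := by
      by_contra h
      exact hZ (hmin _ inferInstance h)
    obtain ⟨m, hmN, hm⟩ := Set.not_subset.mp hZ
    have hm' : ¬ ∀ g, g * m = m * g := fun h => hm (Subgroup.mem_center_iff.mpr h)
    push Not at hm'
    obtain ⟨g, hg⟩ := hm'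
    have hcomN : ∀ a ∈ N, ∀ b ∈ N, a * b = b * a := by
      intro a ha b hb
      haveI : IsMulCommutative N := inferInstance
      exact congrArg Subtype.val (mul_comm' (⟨a, ha⟩ : N) ⟨b, hb⟩)
    have hfix : ∀ n ∈ N, g * n = n * g → n = 1 := by
      intro n hn h
      by_contra h1
      have := aux_prime_le N (Subgroup.centralizer {g}) p hp hcard n hn
        (Subgroup.mem_centralizer_singleton_iff.mpr (by first | exact h | exact h.symm)) h1 hmN
      have h2 := Subgroup.mem_centralizer_singleton_iff.mp this
      exact hg (by first | exact h2 | exact h2.symm)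
    have hA : ∀ x : G, x ∈ Subgroup.centralizer {g} ↔ g * x = x * g := by
      intro x
      rw [Subgroup.mem_centralizer_singleton_iff]
      first | exact Iff.rfl | exact eq_comm
    let f : N → N := fun n => ⟨g * n * g⁻¹ * (n : G)⁻¹, hcomm g n⟩
    have hinj : Function.Injective f := by
      intro a b hab
      have h : g * a * g⁻¹ * (a : G)⁻¹ = g * b * g⁻¹ * (b : G)⁻¹ := congrArg Subtype.val hab
      have h2 := hfix ((b : G)⁻¹ * a) (N.mul_mem (N.inv_mem b.2) a.2) (by
        have h3 : g * a * g⁻¹ = g * b * g⁻¹ * (b : G)⁻¹ * a := by rw [← h]; group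
        calc g * ((b : G)⁻¹ * a) = (g * b * g⁻¹)⁻¹ * (g * a * g⁻¹) * g := by group
          _ = (b : G)⁻¹ * a * g := by rw [h3]; group)
      exact Subtype.ext (inv_mul_eq_one.mp h2).symm
    have hsurj : Function.Surjective f := Finite.injective_iff_surjective.mp hinj
    have hdec : ∀ x : G, ∃ n ∈ N, n * x ∈ Subgroup.centralizer {g} := by
      intro x
      obtain ⟨n, hn⟩ := hsurj (⟨g * x * g⁻¹ * x⁻¹, hcomm g x⟩⁻¹)
      have h : g * n * g⁻¹ * (n : G)⁻¹ = (g * x * g⁻¹ * x⁻¹)⁻¹ := congrArg Subtype.val hn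
      refine ⟨n, n.2, (hA _).mpr ?_⟩
      have hc := hcomN n n.2 _ (hcomm g x)
      calc g * (n * x) = (g * n * g⁻¹ * (n : G)⁻¹) * (n * (g * x * g⁻¹ * x⁻¹)) * x * g := by group
        _ = n * x * g := by rw [h, hc]; group
    have hNA : N ⊓ Subgroup.centralizer {g} = ⊥ := by
      rw [eq_bot_iff]
      rintro n ⟨h1, h2⟩
      exact Subgroup.mem_bot.mpr (hfix n h1 ((hA n).mp h2))
    have hab : ∀ a b : G, a ∈ Subgroup.centralizer {g} → b ∈ Subgroup.centralizer {g} →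
        a * b = b * a := by
      intro a b ha hb
      have h : a * b * a⁻¹ * b⁻¹ ∈ N ⊓ Subgroup.centralizer {g} := ⟨hcomm a b,
        Subgroup.mul_mem _ (Subgroup.mul_mem _ (Subgroup.mul_mem _ ha hb) (Subgroup.inv_mem _ ha))
          (Subgroup.inv_mem _ hb)⟩
      rw [hNA, Subgroup.mem_bot] at h
      calc a * b = (a * b * a⁻¹ * b⁻¹) * (b * a) := by group
        _ = b * a := by rw [h, one_mul]
    have hgA : g ∈ Subgroup.centralizer {g} := (hA g).mpr rfl
    refine ⟨Subgroup.centralizer {g}, ?_, ?_, ?_, hNA, ?_, hab⟩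
    · intro h
      rw [h, Subgroup.mem_bot] at hgA
      exact hg (by rw [hgA]; simp)
    · intro h
      rw [h, inf_top_eq] at hNA
      exact hnt hNA
    · intro x hx
      rw [eq_bot_iff]
      rintro b ⟨hb, c, hc, hcb⟩
      have hcb' : x * c * x⁻¹ = b := hcb
      have hc : c ∈ Subgroup.centralizer {g} := hc
      have hb : b ∈ Subgroup.centralizer {g} := hb
      obtain ⟨n, hn, hnx⟩ := hdec x
      have hn1 : n ≠ 1 := by
        rintro rfl
        exact hx (by simpa using hnx)
      have hbc : b * c⁻¹ ∈ N ⊓ Subgroup.centralizer {g} :=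
        ⟨by rw [← hcb']; exact hcomm x c, Subgroup.mul_mem _ hb (Subgroup.inv_mem _ hc)⟩
      rw [hNA, Subgroup.mem_bot, mul_inv_eq_one] at hbc
      subst hbc
      have hxb : x * b = b * x := by
        calc x * b = (x * b * x⁻¹) * x := by group
          _ = b * x := by rw [hcb']
      have h1 := hab (n * x) b hnx hb
      have hnb : n * b = b * n := by
        have : n * b * x = b * n * x := by
          rw [mul_assoc, ← hxb, ← mul_assoc, h1, mul_assoc]
        exact mul_right_cancel this
      have hNb := aux_prime_le N (Subgroup.centralizer {b}) p hp hcard n hn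
        (Subgroup.mem_centralizer_singleton_iff.mpr (by first | exact hnb | exact hnb.symm)) hn1
      rw [← hcen, Subgroup.mem_center_iff]
      intro y
      obtain ⟨k, hk, hky⟩ := hdec y
      have e1 : k * b = b * k := by
        have := Subgroup.mem_centralizer_singleton_iff.mp (hNb hk)
        first | exact this | exact this.symm
      have e2 := hab _ _ hky hb
      have : k * (y * b) = k * (b * y) := by
        rw [← mul_assoc, e2, ← mul_assoc, ← mul_assoc, e1]
      exact mul_left_cancel this
    · rw [eq_top_iff]
      intro x _
      obtain ⟨n, hn, hnx⟩ := hdec x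
      have : x = n⁻¹ * (n * x) := by group
      rw [this]
      exact Subgroup.mul_mem_sup (inv_mem hn) hnx
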